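/- For every quaternion a ∈ ℍ, the matrix M(a) satisfies M(a) * M(a)ᵀ = (normSq a)² • 1, where normSq a is the quaternion norm-square of a. In particular, if a is a unit quaternion (‖a‖ = 1), then M(a) is an orthogonal matrix: M(a) * M(a)ᵀ = 1. -/

import Mathlib

/-- For a quaternion `a = x + y·i + z·j + w·k`, the associated `3 × 3` real matrix of the
rotation it induces on `ℝ³` (Rodrigues / Euler–Rodrigues formula). -/
noncomputable def quatToMatrix (a : Quaternion ℝ) : Matrix (Fin 3) (Fin 3) ℝ :=
  !![a.re ^ 2 + a.imI ^ 2 - a.imJ ^ 2 - a.imK ^ 2,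
      2 * (a.imI * a.imJ - a.re * a.imK),
      2 * (a.imI * a.imK + a.re * a.imJ);
    2 * (a.imI * a.imJ + a.re * a.imK),
      a.re ^ 2 - a.imI ^ 2 + a.imJ ^ 2 - a.imK ^ 2,
      2 * (a.imJ * a.imK - a.re * a.imI);
    2 * (a.imI * a.imK - a.re * a.imJ),
      2 * (a.imJ * a.imK + a.re * a.imI),
      a.re ^ 2 - a.imI ^ 2 - a.imJ ^ 2 + a.imK ^ 2]

open Matrix

theorem quatToMatrix_mul_transpose (a : Quaternion ℝ) :
    quatToMatrix a * (quatToMatrix a)ᵀ = ((Quaternion.normSq a : ℝ) ^ 2) • 1 := by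
  ext i j
  fin_cases i <;> fin_cases j <;>
    simp [quatToMatrix, Matrix.mul_apply, Fin.sum_univ_three, Quaternion.normSq_def'] <;> ring

theorem stmt_15 (a : Quaternion ℝ) :
    quatToMatrix a * (quatToMatrix a)ᵀ = ((Quaternion.normSq a : ℝ) ^ 2) • 1 ∧
    (‖a‖ = 1 → quatToMatrix a * (quatToMatrix a)ᵀ = 1) := by
  refine ⟨quatToMatrix_mul_transpose a, fun h => ?_⟩
  rw [quatToMatrix_mul_transpose, Quaternion.normSq_eq_norm_mul_self, h]
  simp
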